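/- arXiv:1906.09581 — 2 statements merged into one kernel-verified Lean document; each statement's English description precedes it below -/
import Mathlib

section
/- (Theorem 1, lower bound on the breakdown point.) Let τ > 0, λ > 0, p ≥ 1, and let X ∈ ℝ^{n×p}. Let m be a natural number with m/n < 1/2 and suppose the tuning parameters satisfy min(n − m, m)·λ > τ·√p. Then the robust convex clustering estimator does not break down under m arbitrary outliers: there exists R > 0 such that for every contaminated matrix X̃ ∈ ℝ^{n×p} that differs from X in at most m rows, every global minimizer U of the objective L_τ(·, X̃) satisfies ‖U‖_F ≤ R. -/
/-- The Huber loss with robustification parameter `τ`. -/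
noncomputable def huber (τ a : ℝ) : ℝ := if |a| ≤ τ then a ^ 2 / 2 else τ * |a| - τ ^ 2 / 2

/-- The robust convex clustering objective with unit weights. -/
noncomputable def rccObj (n p : ℕ) (τ lam : ℝ) (X U : Matrix (Fin n) (Fin p) ℝ) : ℝ :=
  (∑ i, ∑ j, huber τ (X i j - U i j)) +
    lam * ∑ q ∈ Finset.univ.filter (fun q : Fin n × Fin n => q.1 < q.2),
      Real.sqrt (∑ j, (U q.1 j - U q.2 j) ^ 2)

theorem huber_le {τ : ℝ} (hτ : 0 < τ) (a : ℝ) : huber τ a ≤ τ * |a| := by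
  unfold huber
  split_ifs with h
  · nlinarith [sq_abs a, abs_nonneg a]
  · nlinarith [sq_nonneg τ]

theorem le_huber (τ a : ℝ) : τ * |a| - τ ^ 2 / 2 ≤ huber τ a := by
  unfold huber
  split_ifs with h
  · nlinarith [sq_abs a, sq_nonneg (|a| - τ)]
  · exact le_rfl

/-- Cost increase of fitting `u` rather than `0` to an arbitrary observation. -/
theorem huber_sub_ge {τ : ℝ} (hτ : 0 < τ) (x u : ℝ) :
    -(τ * |u|) - τ ^ 2 / 2 ≤ huber τ (x - u) - huber τ x := by
  have h : |x| - |u| ≤ |x - u| := abs_sub_abs_le_abs_sub x u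
  nlinarith [huber_le hτ x, le_huber τ (x - u)]

/-- Cost increase of fitting a large `u` rather than `0` to a fixed observation. -/
theorem huber_sub_ge' {τ : ℝ} (hτ : 0 < τ) (x u : ℝ) :
    τ * |u| - 2 * τ * |x| - τ ^ 2 / 2 ≤ huber τ (x - u) - huber τ x := by
  have h : |u| - |x| ≤ |x - u| := abs_sub_comm u x ▸ abs_sub_abs_le_abs_sub u x
  nlinarith [huber_le hτ x, le_huber τ (x - u)]

theorem sum_abs_le_sqrt_card_mul {ι : Type*} [Fintype ι] (a : ι → ℝ) :
    ∑ j, |a j| ≤ √(Fintype.card ι) * √(∑ j, a j ^ 2) := by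
  rw [← Real.sqrt_mul (Nat.cast_nonneg _)]
  refine Real.le_sqrt_of_sq_le ?_
  simpa using sq_sum_le_card_mul_sum_sq (s := Finset.univ) (f := fun j => |a j|)

theorem sqrt_sum_sq_le_sum_abs {ι : Type*} [Fintype ι] (a : ι → ℝ) :
    √(∑ j, a j ^ 2) ≤ ∑ j, |a j| := by
  refine Real.sqrt_le_iff.2 ⟨Finset.sum_nonneg fun _ _ => abs_nonneg _, ?_⟩
  rw [sq, Finset.sum_mul]
  refine Finset.sum_le_sum fun j hj => ?_
  rw [← sq_abs, sq]
  exact mul_le_mul_of_nonneg_left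
    (Finset.single_le_sum (f := fun j => |a j|) (fun _ _ => abs_nonneg _) hj) (abs_nonneg _)

/-- A nonnegative symmetric function summed over pairs between two disjoint sets is at most its sum
over all ordered pairs. -/
theorem sum_product_le_sum_lt {ι : Type*} [Fintype ι] [LinearOrder ι] {s t : Finset ι}
    (hst : Disjoint s t) (f : ι → ι → ℝ) (hf : ∀ i j, 0 ≤ f i j) (hsymm : ∀ i j, f i j = f j i) :
    ∑ i ∈ s, ∑ j ∈ t, f i j ≤
      ∑ q ∈ Finset.univ.filter (fun q : ι × ι => q.1 < q.2), f q.1 q.2 := by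
  have hne {i j : ι} (hi : i ∈ s) (hj : j ∈ t) : i ≠ j := fun h =>
    Finset.disjoint_left.1 hst hi (h ▸ hj)
  let g : ι × ι → ι × ι := fun q => if q.1 < q.2 then q else q.swap
  have hinj : Set.InjOn g (s ×ˢ t : Finset (ι × ι)) := by
    rintro ⟨a, b⟩ hab ⟨c, d⟩ hcd h
    simp only [Finset.coe_product, Set.mem_prod, Finset.mem_coe] at hab hcd
    have h₁ := hne hab.1 hcd.2
    have h₂ := hne hcd.1 hab.2
    simp only [g] at h
    split_ifs at h <;> simp_all
  calc ∑ i ∈ s, ∑ j ∈ t, f i j = ∑ q ∈ s ×ˢ t, f (g q).1 (g q).2 := by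
        rw [← Finset.sum_product']
        refine Finset.sum_congr rfl fun q _ => ?_
        simp only [g]
        split_ifs
        · rfl
        · exact hsymm _ _
    _ = ∑ q ∈ (s ×ˢ t).image g, f q.1 q.2 :=
        (Finset.sum_image (f := fun q : ι × ι => f q.1 q.2) hinj).symm
    _ ≤ _ := by
        refine Finset.sum_le_sum_of_subset_of_nonneg ?_ fun _ _ _ => hf _ _
        intro q hq
        obtain ⟨⟨a, b⟩, hab, rfl⟩ := Finset.mem_image.1 hq
        rw [Finset.mem_product] at hab
        simp only [Finset.mem_filter, Finset.mem_univ, true_and, g]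
        split_ifs with h
        · exact h
        · exact lt_of_le_of_ne (not_lt.1 h) (hne hab.1 hab.2).symm

/-- The energy gap between `U` and `0`, in terms of the clean rows `C` and outlying rows `Cᶜ`. -/
theorem rccObj_sub_ge {n p : ℕ} {τ lam : ℝ} (hτ : 0 < τ) (hlam : 0 ≤ lam)
    (X Xt U : Matrix (Fin n) (Fin p) ℝ) (C : Finset (Fin n)) (hC : ∀ i ∈ C, Xt i = X i) :
    τ * ∑ i ∈ C, ∑ j, |U i j| - τ * ∑ i ∈ Cᶜ, ∑ j, |U i j| +
        lam * ∑ i ∈ C, ∑ o ∈ Cᶜ, √(∑ j, (U i j - U o j) ^ 2) -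
        ∑ i, ∑ j, (2 * τ * |X i j| + τ ^ 2 / 2) ≤
      rccObj n p τ lam Xt U - rccObj n p τ lam Xt 0 := by
  have hpen := mul_le_mul_of_nonneg_left (sum_product_le_sum_lt (disjoint_compl_right (a := C))
    (fun i o => √(∑ j, (U i j - U o j) ^ 2)) (fun _ _ => Real.sqrt_nonneg _)
    (fun i o => by simp_rw [sub_sq_comm])) hlam
  have hclean : ∑ i ∈ C, ∑ j, (τ * |U i j| - (2 * τ * |X i j| + τ ^ 2 / 2)) ≤
      ∑ i ∈ C, ∑ j, (huber τ (Xt i j - U i j) - huber τ (Xt i j)) := by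
    refine Finset.sum_le_sum fun i hi => Finset.sum_le_sum fun j _ => ?_
    rw [hC i hi]
    linarith [huber_sub_ge' hτ (X i j) (U i j)]
  have hout : ∑ i ∈ Cᶜ, ∑ j, (-(τ * |U i j|) - (2 * τ * |X i j| + τ ^ 2 / 2)) ≤
      ∑ i ∈ Cᶜ, ∑ j, (huber τ (Xt i j - U i j) - huber τ (Xt i j)) := by
    refine Finset.sum_le_sum fun i _ => Finset.sum_le_sum fun j _ => ?_
    have : 0 ≤ 2 * τ * |X i j| := by positivity
    linarith [huber_sub_ge hτ (Xt i j) (U i j)]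
  simp only [Finset.sum_sub_distrib, Finset.sum_neg_distrib, ← Finset.mul_sum] at hclean hout
  have h₁ := Finset.sum_add_sum_compl C fun i => ∑ j, huber τ (Xt i j - U i j)
  have h₂ := Finset.sum_add_sum_compl C fun i => ∑ j, huber τ (Xt i j)
  have h₃ := Finset.sum_add_sum_compl C fun i => ∑ j, (2 * τ * |X i j| + τ ^ 2 / 2)
  simp only [rccObj, Matrix.zero_apply, sub_zero, sub_self, ne_eq, OfNat.ofNat_ne_zero,
    not_false_eq_true, zero_pow, Finset.sum_const_zero, Real.sqrt_zero, mul_zero, add_zero]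
  linarith

/-- Each row outside `C` is compared with every row of `C`. -/
theorem card_mul_sum_abs_compl_le {n p : ℕ} (U : Matrix (Fin n) (Fin p) ℝ) (C : Finset (Fin n)) :
    (C.card : ℝ) * ∑ o ∈ Cᶜ, ∑ j, |U o j| ≤ (Cᶜ.card : ℝ) * ∑ i ∈ C, ∑ j, |U i j| +
      √p * ∑ i ∈ C, ∑ o ∈ Cᶜ, √(∑ j, (U i j - U o j) ^ 2) := by
  have h : ∑ i ∈ C, ∑ o ∈ Cᶜ, ∑ j, |U o j| ≤
      ∑ i ∈ C, ∑ o ∈ Cᶜ, (∑ j, |U i j| + √p * √(∑ j, (U i j - U o j) ^ 2)) := by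
    refine Finset.sum_le_sum fun i _ => Finset.sum_le_sum fun o _ => ?_
    have h₁ : ∑ j, |U o j| ≤ ∑ j, (|U i j| + |U i j - U o j|) :=
      Finset.sum_le_sum fun j _ => by
        linarith [abs_sub_abs_le_abs_sub (U o j) (U i j), abs_sub_comm (U o j) (U i j)]
    have h₂ := sum_abs_le_sqrt_card_mul fun j => U i j - U o j
    rw [Finset.sum_add_distrib] at h₁
    rw [Fintype.card_fin] at h₂
    linarith
  simpa only [Finset.sum_add_distrib, Finset.sum_const, nsmul_eq_mul, ← Finset.mul_sum] using h

/-- Theorem 1 (lower bound on the breakdown point): under `m/n < 1/2` and the tuning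
condition `min(n − m, m) · λ > τ √p`, the robust convex clustering estimator stays bounded
under `m` arbitrary outliers. -/
theorem rcc_breakdown_lower_bound (n p m : ℕ) (τ lam : ℝ) (hτ : 0 < τ) (hlam : 0 < lam)
    (hp : 1 ≤ p) (X : Matrix (Fin n) (Fin p) ℝ)
    (hm : (m : ℝ) / (n : ℝ) < 1 / 2)
    (htune : τ * Real.sqrt p < (↑(min (n - m) m) : ℝ) * lam) :
    ∃ R > (0 : ℝ), ∀ Xt : Matrix (Fin n) (Fin p) ℝ,
      {i : Fin n | Xt i ≠ X i}.ncard ≤ m →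
      ∀ U : Matrix (Fin n) (Fin p) ℝ,
        (∀ V, rccObj n p τ lam Xt U ≤ rccObj n p τ lam Xt V) →
        Real.sqrt (∑ i, ∑ j, (U i j) ^ 2) ≤ R := by
  have hmpos : 0 < m := by
    rcases Nat.eq_zero_or_pos m with rfl | h
    · have : 0 ≤ τ * √p := by positivity
      simp at htune
      linarith
    · exact h
  have hnpos : 0 < n := by
    rcases Nat.eq_zero_or_pos n with rfl | h
    · have : 0 ≤ τ * √p := by positivity
      simp at htune
      linarith
    · exact h
  have hnm : 2 * m < n := by
    rw [div_lt_div_iff₀ (by positivity) two_pos] at hm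
    have : (2 * m : ℝ) < n := by linarith
    exact_mod_cast this
  rw [min_eq_right (by omega)] at htune
  obtain ⟨d, hd⟩ : ∃ d, d = m * lam - τ * √p := ⟨_, rfl⟩
  have hdpos : 0 < d := by linarith
  set K := ∑ i, ∑ j, (2 * τ * |X i j| + τ ^ 2 / 2) with hK
  have hK0 : 0 ≤ K := by positivity
  refine ⟨2 * (n * K / τ) + √p * (n * K / d) + 1, by positivity, fun Xt hXt U hU => ?_⟩
  classical
  let C : Finset (Fin n) := Finset.univ.filter fun i => Xt i = X i
  have hO : Cᶜ.card ≤ m := by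
    rw [← Set.ncard_coe_finset]
    convert hXt using 2
    ext i
    simp [C]
  have hCO : C.card + Cᶜ.card = n := by simp
  have hgap := rccObj_sub_ge hτ hlam.le X Xt U C fun i hi => (Finset.mem_filter.1 hi).2
  have hcross := card_mul_sum_abs_compl_le U C
  have htotal := Finset.sum_add_sum_compl C fun i => ∑ j, |U i j|
  have hU0 := hU 0
  have hfrob := sqrt_sum_sq_le_sum_abs fun q : Fin n × Fin p => U q.1 q.2
  simp only [Fintype.sum_prod_type] at hfrob
  set A := ∑ i ∈ C, ∑ j, |U i j|
  set S := ∑ o ∈ Cᶜ, ∑ j, |U o j|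
  set B := ∑ i ∈ C, ∑ o ∈ Cᶜ, √(∑ j, (U i j - U o j) ^ 2)
  have hA0 : 0 ≤ A := by positivity
  have hB0 : 0 ≤ B := by positivity
  have hcm : (m : ℝ) + 1 ≤ C.card := by exact_mod_cast (by omega : m + 1 ≤ C.card)
  have hkm : (Cᶜ.card : ℝ) ≤ m := by exact_mod_cast hO
  have hcn : (C.card : ℝ) ≤ n := by exact_mod_cast (by omega : C.card ≤ n)
  generalize (C.card : ℝ) = c at *
  generalize (Cᶜ.card : ℝ) = k at *
  have hm0 : (0 : ℝ) < m := by exact_mod_cast hmpos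
  have hc0 : 0 < c := by linarith
  have hsB : 0 ≤ √p * B := by positivity
  have hSle : S ≤ A + √p * B := by
    have : c * S ≤ c * (A + √p * B) := by
      nlinarith [mul_le_mul_of_nonneg_right (by linarith : k ≤ c) hA0,
        mul_le_mul_of_nonneg_right (by linarith : 1 ≤ c) hsB]
    exact le_of_mul_le_mul_left this hc0
  have hmain : τ * A + d * B ≤ n * K := by
    have h₁ : c * (τ * A - τ * S + lam * B) ≤ c * K :=
      mul_le_mul_of_nonneg_left (by linarith) hc0.le
    have h₂ := mul_le_mul_of_nonneg_left hcross hτ.le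
    have h₃ : τ * A ≤ (c - k) * (τ * A) := le_mul_of_one_le_left (by positivity) (by linarith)
    have h₄ : m * (lam * B) ≤ c * (lam * B) :=
      mul_le_mul_of_nonneg_right (by linarith) (by positivity)
    have h₅ := mul_le_mul_of_nonneg_right hcn hK0
    rw [hd]
    linarith
  have hA : A ≤ n * K / τ := by
    rw [le_div_iff₀ hτ]
    nlinarith [mul_nonneg hdpos.le hB0]
  have hB : B ≤ n * K / d := by
    rw [le_div_iff₀ hdpos]
    nlinarith [mul_nonneg hτ.le hA0]
  have hpB := mul_le_mul_of_nonneg_left hB (Real.sqrt_nonneg p)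
  linarith
end

section
/- For every τ > 0 and all real s, t such that |s + t| ≤ τ and |s| ≥ τ (so that st ≤ 0), the Huber loss satisfies ℓ_τ(s + t) ≤ ℓ_τ(s) + ℓ_τ(t). -/
theorem huber_nonneg {τ : ℝ} (hτ : 0 ≤ τ) (a : ℝ) : 0 ≤ huber τ a := by
  unfold huber
  split_ifs with h
  · positivity
  · nlinarith

theorem sq_div_two_le_huber {τ a : ℝ} (hτ : 0 ≤ τ) (h : τ ≤ |a|) : τ ^ 2 / 2 ≤ huber τ a := by
  unfold huber
  split_ifs
  · nlinarith [sq_abs a]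
  · nlinarith

theorem huber_add_le_case23 (τ s t : ℝ) (hτ : 0 < τ) (h1 : |s + t| ≤ τ) (h2 : τ ≤ |s|) :
    huber τ (s + t) ≤ huber τ s + huber τ t := by
  have hst : huber τ (s + t) ≤ τ ^ 2 / 2 := by
    rw [huber, if_pos h1]
    nlinarith [sq_abs (s + t), abs_nonneg (s + t)]
  linarith [sq_div_two_le_huber hτ.le h2, huber_nonneg hτ.le t]
end
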